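/- For every q with (1+√5)/2 < q < q_{ℵ₀}, there is no x ∈ (0, 1/(q−1)) whose set of q-expansions is countably infinite; i.e., ((1+√5)/2, q_{ℵ₀}) ∩ B_{ℵ₀} = ∅. -/

import Mathlib

noncomputable section

open Set

/-- The map `T_{q,i}(x) = q*x - i` for a binary digit `i`. -/
def Tmap (q : ℝ) (i : Fin 2) (x : ℝ) : ℝ := q * x - ((i : ℕ) : ℝ)

/-- The value `((ε_i)_{i=1}^∞)_q = ∑_{i=1}^∞ ε_i q^{-i}` of a binary sequence in base `q`
(the sequence is 0-indexed, so digit `ε i` has weight `q^{-(i+1)}`). -/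
def seqVal (q : ℝ) (ε : ℕ → Fin 2) : ℝ := ∑' i : ℕ, ((ε i : ℕ) : ℝ) / q ^ (i + 1)

/-- `Σ_q(x)`: the set of `q`-expansions of `x`. -/
def SigmaSet (q x : ℝ) : Set (ℕ → Fin 2) := {ε | x = seqVal q ε}

/-- The interval `I_q = [0, 1/(q-1)]`. -/
def Iq (q : ℝ) : Set ℝ := Icc 0 (1 / (q - 1))

/-- The switch region `S_q = [1/q, 1/(q(q-1))]`. -/
def Sq (q : ℝ) : Set ℝ := Icc (1 / q) (1 / (q * (q - 1)))

/-- The interval `J_q = [(q+q²)/(q⁴-1), (1+q³)/(q⁴-1)]`. -/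
def Jq (q : ℝ) : Set ℝ := Icc ((q + q ^ 2) / (q ^ 4 - 1)) ((1 + q ^ 3) / (q ^ 4 - 1))

/-- Apply the first `n` maps of a sequence of maps to `x`:
`applySeq a n x = (a_{n-1} ∘ ⋯ ∘ a_0)(x)`. -/
def applySeq (a : ℕ → ℝ → ℝ) (n : ℕ) (x : ℝ) : ℝ := (List.range n).foldl (fun y k => a k y) x

/-- `Ω_q(x)`: the set of sequences of maps, each equal to `T_{q,0}` or `T_{q,1}`,
all of whose partial compositions applied to `x` stay in `I_q`. -/
def OmegaSet (q x : ℝ) : Set (ℕ → ℝ → ℝ) :=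
  {a | (∀ n, a n = Tmap q 0 ∨ a n = Tmap q 1) ∧ ∀ n : ℕ, applySeq a (n + 1) x ∈ Iq q}

/-- Apply a finite word of digits to `x` (first letter applied first):
for `a = [a₁, …, aₙ]`, `wordMap q a x = (T_{q,aₙ} ∘ ⋯ ∘ T_{q,a₁})(x)`. -/
def wordMap (q : ℝ) (a : List (Fin 2)) (x : ℝ) : ℝ := a.foldl (fun y i => Tmap q i y) x

/-- A branching sequence for `x`: a finite word whose partial compositions applied to `x`
stay in `I_q`, and whose full composition maps `x` into the switch region `S_q`. -/
def IsBranching (q x : ℝ) (a : List (Fin 2)) : Prop :=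
  (∀ k, k ≤ a.length → wordMap q (a.take k) x ∈ Iq q) ∧ wordMap q a x ∈ Sq q

/-- `x` is a `q` null infinite point: `x ∈ (0,1/(q-1))`, `Ω_q(x)` is infinite, and for every
branching sequence `a` for `x` there is a digit `i` with `Ω_q(T_{q,i}(a(x)))` finite. -/
def NullInfinite (q x : ℝ) : Prop :=
  x ∈ Ioo 0 (1 / (q - 1)) ∧ (OmegaSet q x).Infinite ∧
    ∀ a : List (Fin 2), IsBranching q x a →
      ∃ i : Fin 2, (OmegaSet q (Tmap q i (wordMap q a x))).Finite

/-- `U_q`: points of `I_q` with exactly one `q`-expansion. -/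
def UniqSet (q : ℝ) : Set ℝ := {x | x ∈ Iq q ∧ ∃! ε : ℕ → Fin 2, ε ∈ SigmaSet q x}

/-- `B_{ℵ₀}`: bases `q ∈ (1,2)` for which some `x ∈ (0,1/(q-1))` has exactly countably
infinitely many `q`-expansions. -/
def BAleph0 : Set ℝ :=
  {q | q ∈ Ioo (1 : ℝ) 2 ∧ ∃ x ∈ Ioo (0 : ℝ) (1 / (q - 1)),
    Cardinal.mk ↥(SigmaSet q x) = Cardinal.aleph0}

/-- The eventually periodic binary sequence `u w^∞`: the finite word `u` followed by
infinitely many repetitions of the finite word `w`. -/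
def uwInf (u w : List (Fin 2)) : ℕ → Fin 2 := fun i =>
  if i < u.length then u.getD i 0 else w.getD ((i - u.length) % w.length) 0

/-- Prepend a digit to a sequence. -/
def consSeq (i : Fin 2) (ε : ℕ → Fin 2) : ℕ → Fin 2
  | 0 => i
  | n + 1 => ε n

/-- Delete the first digit of a sequence. -/
def tailSeq (ε : ℕ → Fin 2) : ℕ → Fin 2 := fun n => ε (n + 1)

/-- Exchange the digits `0` and `1`. -/
def flipSeq (ε : ℕ → Fin 2) : ℕ → Fin 2 := fun n => Fin.rev (ε n)

lemma consSeq_head_tail (ε : ℕ → Fin 2) : consSeq (ε 0) (tailSeq ε) = ε := by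
  funext n
  cases n <;> rfl

lemma tailSeq_consSeq (i : Fin 2) (ε : ℕ → Fin 2) : tailSeq (consSeq i ε) = ε := rfl

lemma consSeq_injective (i : Fin 2) : Function.Injective (consSeq i) :=
  Function.LeftInverse.injective (tailSeq_consSeq i)

lemma flipSeq_flipSeq (ε : ℕ → Fin 2) : flipSeq (flipSeq ε) = ε := by
  funext n
  simp [flipSeq]

lemma continuous_tailSeq : Continuous tailSeq :=
  continuous_pi fun n => continuous_apply (n + 1)

lemma continuous_flipSeq : Continuous flipSeq :=
  continuous_pi fun n => (continuous_of_discreteTopology (f := @Fin.rev 2)).comp (continuous_apply n)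

/-- An infinite set of sequences that no clopen set splits into two infinite parts. -/
def ClopenIndecomposable (A : Set (ℕ → Fin 2)) : Prop :=
  A.Infinite ∧ ∀ C : Set (ℕ → Fin 2), IsClopen C → (A ∩ C).Finite ∨ (A \ C).Finite

namespace ClopenIndecomposable

lemma subset {A B : Set (ℕ → Fin 2)} (hA : ClopenIndecomposable A) (hBA : B ⊆ A)
    (hB : B.Infinite) : ClopenIndecomposable B :=
  ⟨hB, fun C hC => (hA.2 C hC).imp (fun h => h.subset (inter_subset_inter_left C hBA))
    (fun h => h.subset (sdiff_subset_sdiff_left hBA))⟩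

lemma of_image {f g : (ℕ → Fin 2) → ℕ → Fin 2} (hg : Continuous g)
    (hgf : Function.LeftInverse g f) {B : Set (ℕ → Fin 2)}
    (h : ClopenIndecomposable (f '' B)) : ClopenIndecomposable B := by
  refine ⟨h.1.of_image f, fun C hC => ?_⟩
  refine (h.2 (g ⁻¹' C) (hC.preimage hg)).imp (fun hf => ?_) (fun hf => ?_)
  · refine Finite.of_finite_image (f := f) (hf.subset ?_) hgf.injective.injOn
    rintro _ ⟨ε, ⟨h1, h2⟩, rfl⟩
    exact ⟨mem_image_of_mem f h1, by simpa [hgf ε] using h2⟩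
  · refine Finite.of_finite_image (f := f) (hf.subset ?_) hgf.injective.injOn
    rintro _ ⟨ε, ⟨h1, h2⟩, rfl⟩
    exact ⟨mem_image_of_mem f h1, by simpa [hgf ε] using h2⟩

end ClopenIndecomposable

/-- An infinite countable closed set of binary sequences contains a clopen indecomposable piece:
intersect it with a cylinder isolating a point of its derived set. -/
lemma exists_clopenIndecomposable_inter_cylinder {A : Set (ℕ → Fin 2)} (hA : IsClosed A)
    (hinf : A.Infinite) (hcount : A.Countable) :
    ∃ ε n, ClopenIndecomposable (A ∩ PiNat.cylinder ε n) := by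
  have hDA : derivedSet A ⊆ A := (isClosed_iff_derivedSet_subset A).1 hA
  have hne : (derivedSet A).Nonempty := by
    obtain ⟨ε, -, hε⟩ := hinf.exists_accPt_of_subset_isCompact isCompact_univ (subset_univ A)
    exact ⟨ε, hε⟩
  have hnp : ¬ Preperfect (derivedSet A) := by
    intro hp
    let _ : MetricSpace (ℕ → Fin 2) := TopologicalSpace.metrizableSpaceMetric (ℕ → Fin 2)
    obtain ⟨f, hf, -, hinj⟩ :=
      Perfect.exists_nat_bool_injection ⟨isClosed_derivedSet A, hp⟩ hne
    have h1 : (range f).Countable := hcount.mono (hf.trans hDA)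
    have h2 : Countable (ℕ → Bool) := by
      rw [← Set.countable_univ_iff]
      exact countable_of_injective_of_countable_image hinj.injOn (by simpa using h1)
    have h3 : Cardinal.mk (ℕ → Bool) ≤ Cardinal.aleph0 := Cardinal.mk_le_aleph0_iff.2 h2
    simp only [Cardinal.mk_pi, Cardinal.mk_bool, Cardinal.prod_const, Cardinal.lift_ofNat,
      Cardinal.mk_nat, Cardinal.lift_aleph0] at h3
    exact absurd h3 (not_le.2 (Cardinal.cantor _))
  obtain ⟨ε, hε, hiso⟩ : ∃ ε ∈ derivedSet A, ¬ AccPt ε (Filter.principal (derivedSet A)) := by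
    by_contra! h
    exact hnp h
  rw [accPt_iff_nhds] at hiso
  push Not at hiso
  obtain ⟨U, hU, hUD⟩ := hiso
  obtain ⟨V, ⟨ε', n, rfl⟩, hεV, hVU⟩ :=
    (PiNat.isTopologicalBasis_cylinders (fun _ : ℕ => Fin 2)).mem_nhds_iff.1 hU
  have hVc : IsClosed (PiNat.cylinder ε' n) := by
    rw [PiNat.cylinder_eq_pi]
    exact isClosed_set_pi fun i _ => isClosed_discrete _
  have hcyl : PiNat.cylinder ε' n ∈ nhds ε := (PiNat.isOpen_cylinder _ ε' n).mem_nhds hεV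
  have hacc : ∀ B ⊆ A ∩ PiNat.cylinder ε' n, B.Infinite → ε ∈ closure B := by
    intro B hB hBinf
    obtain ⟨δ, hδK, hδ⟩ := hBinf.exists_accPt_of_subset_isCompact
      (hA.inter hVc).isCompact hB
    have : δ = ε := hUD δ ⟨hVU hδK.2,
      hδ.mono (Filter.principal_mono.2 (hB.trans inter_subset_left))⟩
    exact this ▸ derivedSet_subset_closure B hδ
  refine ⟨ε', n, ?_, fun C hC => ?_⟩
  · have hε' : AccPt ε (Filter.principal A) := hε
    intro hfin
    have h1 : AccPt ε (Filter.principal (A ∩ PiNat.cylinder ε' n)) := by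
      rw [accPt_iff_nhds] at hε' ⊢
      intro W hW
      obtain ⟨δ, ⟨⟨hδW, hδV⟩, hδA⟩, hne⟩ := hε' _ (Filter.inter_mem hW hcyl)
      exact ⟨δ, ⟨hδW, hδA, hδV⟩, hne⟩
    exact (Set.Infinite.of_accPt h1) hfin
  · by_contra! h
    have h1 := hC.1.closure_subset_iff.2 inter_subset_right (hacc _ inter_subset_left h.1)
    have h2 := hC.compl.1.closure_subset_iff.2 (fun _ hx => hx.2) (hacc _ sdiff_subset h.2)
    exact h2 h1

lemma digit_div_pow_le {q : ℝ} (hq : 1 < q) (i : Fin 2) (n : ℕ) :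
    ((i : ℕ) : ℝ) / q ^ (n + 1) ≤ (q⁻¹) ^ (n + 1) := by
  have hi : ((i : ℕ) : ℝ) ≤ 1 := by exact_mod_cast Nat.le_of_lt_succ i.2
  rw [inv_pow, ← one_div]
  gcongr

lemma hasSum_inv_pow_succ {q : ℝ} (hq : 1 < q) :
    HasSum (fun n : ℕ => (q⁻¹) ^ (n + 1)) (1 / (q - 1)) := by
  have h := (hasSum_geometric_of_lt_one (inv_nonneg.2 (by linarith : (0 : ℝ) ≤ q))
    (inv_lt_one_of_one_lt₀ hq)).mul_left q⁻¹
  have h1 : q⁻¹ * (1 - q⁻¹)⁻¹ = 1 / (q - 1) := by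
    have : q - 1 ≠ 0 := by linarith
    have : q ≠ 0 := by linarith
    field_simp
  rw [h1] at h
  simpa only [pow_succ'] using h

lemma summable_digits {q : ℝ} (hq : 1 < q) (ε : ℕ → Fin 2) :
    Summable fun n : ℕ => ((ε n : ℕ) : ℝ) / q ^ (n + 1) :=
  Summable.of_nonneg_of_le (fun n => by positivity) (fun n => digit_div_pow_le hq (ε n) n)
    (hasSum_inv_pow_succ hq).summable

lemma seqVal_nonneg {q : ℝ} (hq : 1 < q) (ε : ℕ → Fin 2) : 0 ≤ seqVal q ε :=
  tsum_nonneg fun n => by positivity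

lemma seqVal_flipSeq {q : ℝ} (hq : 1 < q) (ε : ℕ → Fin 2) :
    seqVal q (flipSeq ε) = 1 / (q - 1) - seqVal q ε := by
  rw [seqVal, seqVal, ← (hasSum_inv_pow_succ hq).tsum_eq,
    ← (hasSum_inv_pow_succ hq).summable.tsum_sub (summable_digits hq ε)]
  congr 1 with n
  have h : ∀ i : Fin 2, ((Fin.rev i : ℕ) : ℝ) = 1 - ((i : ℕ) : ℝ) := by
    intro i
    fin_cases i <;> simp [Fin.rev]
  rw [flipSeq, h, inv_pow, sub_div, one_div]

lemma seqVal_le {q : ℝ} (hq : 1 < q) (ε : ℕ → Fin 2) : seqVal q ε ≤ 1 / (q - 1) := by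
  have h := seqVal_nonneg hq (flipSeq ε)
  rw [seqVal_flipSeq hq] at h
  linarith

lemma seqVal_consSeq {q : ℝ} (hq : 1 < q) (i : Fin 2) (ε : ℕ → Fin 2) :
    seqVal q (consSeq i ε) = (((i : ℕ) : ℝ) + seqVal q ε) / q := by
  rw [seqVal, (summable_digits hq (consSeq i ε)).tsum_eq_zero_add, seqVal, add_div, ← tsum_div_const]
  congr 1
  · simp [consSeq]
  · congr 1 with n
    rw [div_div, ← pow_succ, consSeq]

lemma continuous_seqVal {q : ℝ} (hq : 1 < q) : Continuous (seqVal q) := by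
  refine continuous_tsum (u := fun n : ℕ => (q⁻¹) ^ (n + 1)) (fun n => ?_)
    (hasSum_inv_pow_succ hq).summable fun n ε => ?_
  · exact ((continuous_of_discreteTopology (f := fun i : Fin 2 => ((i : ℕ) : ℝ))).comp
      (continuous_apply n)).div_const _
  · rw [Real.norm_of_nonneg (by positivity)]
    exact digit_div_pow_le hq (ε n) n

lemma isClosed_SigmaSet {q : ℝ} (hq : 1 < q) (x : ℝ) : IsClosed (SigmaSet q x) :=
  isClosed_eq continuous_const (continuous_seqVal hq)

lemma Tmap_zero (q x : ℝ) : Tmap q 0 x = q * x := by simp [Tmap]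

lemma Tmap_one (q x : ℝ) : Tmap q 1 x = q * x - 1 := by simp [Tmap]

lemma consSeq_mem_SigmaSet {q : ℝ} (hq : 1 < q) {x : ℝ} {i : Fin 2} {ε : ℕ → Fin 2} :
    consSeq i ε ∈ SigmaSet q x ↔ ε ∈ SigmaSet q (Tmap q i x) := by
  have hq0 : q ≠ 0 := by linarith
  simp only [SigmaSet, mem_ofPred_eq, seqVal_consSeq hq, Tmap]
  rw [eq_div_iff hq0, sub_eq_iff_eq_add, mul_comm, add_comm]

lemma tailSeq_mem_SigmaSet {q : ℝ} (hq : 1 < q) {x : ℝ} {ε : ℕ → Fin 2} (h : ε ∈ SigmaSet q x) :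
    tailSeq ε ∈ SigmaSet q (Tmap q (ε 0) x) := by
  rwa [← consSeq_mem_SigmaSet hq, consSeq_head_tail]

lemma image_consSeq_SigmaSet {q : ℝ} (hq : 1 < q) (x : ℝ) (i : Fin 2) :
    consSeq i '' SigmaSet q (Tmap q i x) = SigmaSet q x ∩ {ε | ε 0 = i} := by
  ext ε
  constructor
  · rintro ⟨δ, hδ, rfl⟩
    exact ⟨(consSeq_mem_SigmaSet hq).2 hδ, rfl⟩
  · rintro ⟨hε, rfl⟩
    exact ⟨tailSeq ε, tailSeq_mem_SigmaSet hq hε, consSeq_head_tail ε⟩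

lemma image_flipSeq_SigmaSet {q : ℝ} (hq : 1 < q) (x : ℝ) :
    flipSeq '' SigmaSet q (1 / (q - 1) - x) = SigmaSet q x := by
  have key : ∀ y δ, δ ∈ SigmaSet q y → flipSeq δ ∈ SigmaSet q (1 / (q - 1) - y) := by
    intro y δ hδ
    simp only [SigmaSet, mem_ofPred_eq] at hδ ⊢
    rw [seqVal_flipSeq hq, ← hδ]
  ext ε
  constructor
  · rintro ⟨δ, hδ, rfl⟩
    simpa using key _ δ hδ
  · intro hε
    exact ⟨flipSeq ε, key x ε hε, flipSeq_flipSeq ε⟩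

lemma mem_Iq_of_nonempty {q : ℝ} (hq : 1 < q) {x : ℝ} (h : (SigmaSet q x).Nonempty) :
    x ∈ Iq q := by
  obtain ⟨ε, hε⟩ := h
  rw [SigmaSet, mem_ofPred_eq] at hε
  exact hε ▸ ⟨seqVal_nonneg hq ε, seqVal_le hq ε⟩

/-- The orbit of `x` under the map that applies `T_{q,1}` whenever the result is nonnegative. -/
def greedyOrbit (q x : ℝ) : ℕ → ℝ
  | 0 => x
  | n + 1 => if 1 ≤ q * greedyOrbit q x n then q * greedyOrbit q x n - 1 else q * greedyOrbit q x n

/-- The greedy expansion of `x`. -/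
def greedyDigit (q x : ℝ) (n : ℕ) : Fin 2 := if 1 ≤ q * greedyOrbit q x n then 1 else 0

lemma SigmaSet_nonempty {q : ℝ} (hq : q ∈ Ioo (1 : ℝ) 2) {x : ℝ} (hx : x ∈ Iq q) :
    (SigmaSet q x).Nonempty := by
  have hq1 := hq.1
  have hq2 := hq.2
  have hR : 1 < 1 / (q - 1) := by
    rw [lt_div_iff₀ (by linarith)]
    linarith
  have hR' : (q - 1) * (1 / (q - 1)) = 1 := mul_one_div_cancel (by linarith)
  have hmem : ∀ n, greedyOrbit q x n ∈ Iq q := by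
    intro n
    induction n with
    | zero => exact hx
    | succ n ih =>
      obtain ⟨h0, h1⟩ := ih
      rw [greedyOrbit]
      split_ifs with h
      · exact ⟨by linarith, by nlinarith⟩
      · exact ⟨by positivity, by linarith⟩
  have hsum : ∀ n, ∑ k ∈ Finset.range n, ((greedyDigit q x k : ℕ) : ℝ) / q ^ (k + 1) =
      x - greedyOrbit q x n * (q⁻¹) ^ n := by
    intro n
    induction n with
    | zero => simp [greedyOrbit]
    | succ n ih =>
      have hq0 : q ≠ 0 := by linarith
      rw [Finset.sum_range_succ, ih, greedyDigit, greedyOrbit]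
      split_ifs <;> simp only [inv_pow, Fin.val_one, Fin.val_zero, Nat.cast_one, Nat.cast_zero] <;>
        field_simp <;> ring
  refine ⟨greedyDigit q x, ?_⟩
  have hlim : Filter.Tendsto (fun n => x - greedyOrbit q x n * (q⁻¹) ^ n) Filter.atTop
      (nhds (x - 0)) := by
    refine tendsto_const_nhds.sub ?_
    have h0 : Filter.Tendsto (fun n : ℕ => 1 / (q - 1) * (q⁻¹) ^ n) Filter.atTop (nhds 0) := by
      simpa using (tendsto_pow_atTop_nhds_zero_of_lt_one (inv_nonneg.2 (by linarith : (0 : ℝ) ≤ q))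
        (inv_lt_one_of_one_lt₀ hq1)).const_mul (1 / (q - 1))
    refine squeeze_zero (fun n => ?_) (fun n => ?_) h0
    · have := (hmem n).1
      positivity
    · have := (hmem n).2
      gcongr
  have h := (summable_digits hq1 (greedyDigit q x)).hasSum.tendsto_sum_nat
  simp only [hsum] at h
  exact (sub_zero x).symm.trans (tendsto_nhds_unique hlim h)

/-- The length `1 / (q - 1) - 1` of the image of the switch region under `T_{q,1}`. -/
def gap (q : ℝ) : ℝ := 1 / (q - 1) - 1

/-- The value of the sequence `0^k (10)^∞` in base `q`. -/
def altTail (q : ℝ) (k : ℕ) : ℝ := q / (q ^ 2 - 1) / q ^ k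

/-- The bases lying strictly between the golden ratio and the root of
`x⁶ = x⁴ + x³ + 2x² + x + 1`, described by polynomial inequalities. -/
structure SmallBase (q : ℝ) : Prop where
  one_lt : 1 < q
  golden : 0 < q ^ 2 - q - 1
  sextic : 0 < q ^ 4 + q ^ 3 + 2 * q ^ 2 + q + 1 - q ^ 6

lemma mul_altTail_succ {q : ℝ} (hq : q ≠ 0) (k : ℕ) : q * altTail q (k + 1) = altTail q k := by
  rw [altTail, altTail, pow_succ q k, ← div_div, mul_div_cancel₀ _ hq]

namespace SmallBase

variable {q : ℝ}

lemma ne_zero (h : SmallBase q) : q ≠ 0 := by linarith [h.one_lt]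

lemma sub_one_ne (h : SmallBase q) : q - 1 ≠ 0 := by linarith [h.one_lt]

lemma sq_sub_one_pos (h : SmallBase q) : 0 < q ^ 2 - 1 := by nlinarith [h.one_lt]

lemma sq_sub_one_ne (h : SmallBase q) : q ^ 2 - 1 ≠ 0 := h.sq_sub_one_pos.ne'

lemma lt_bound (h : SmallBase q) : q < 1.6455 := by
  by_contra! hq
  obtain ⟨t, ht, rfl⟩ : ∃ t, 0 ≤ t ∧ q = 1.6455 + t := ⟨q - 1.6455, by linarith, by ring⟩
  have := h.sextic
  ring_nf at this
  nlinarith [pow_nonneg ht 2, pow_nonneg ht 3, pow_nonneg ht 4, pow_nonneg ht 5, pow_nonneg ht 6]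

lemma bound_lt (h : SmallBase q) : 1.618 < q := by
  nlinarith [h.golden, h.one_lt]

lemma golden_lt (h : SmallBase q) : q ^ 2 - q - 1 < 0.0622 := by
  nlinarith [h.lt_bound, h.one_lt]

lemma pow_lt_bound (h : SmallBase q) (n : ℕ) (hn : n ≠ 0) : q ^ n < 1.6455 ^ n :=
  pow_lt_pow_left₀ h.lt_bound (by linarith [h.one_lt]) hn

lemma altTail_pos (h : SmallBase q) (k : ℕ) : 0 < altTail q k := by
  have := h.sq_sub_one_pos
  have := h.one_lt
  rw [altTail]
  positivity

lemma altTail_lt_succ (h : SmallBase q) (k : ℕ) : altTail q (k + 1) < altTail q k := by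
  have := mul_altTail_succ h.ne_zero k
  nlinarith [h.altTail_pos (k + 1), h.one_lt]

lemma altTail_strictAnti (h : SmallBase q) : StrictAnti (altTail q) :=
  strictAnti_nat_of_succ_lt h.altTail_lt_succ

lemma altTail_between (h : SmallBase q) {k l : ℕ} (h1 : altTail q (l + 1) < altTail q k)
    (h2 : altTail q k < altTail q l) : False := by
  have := h.altTail_strictAnti.lt_iff_gt.1 h1
  have := h.altTail_strictAnti.lt_iff_gt.1 h2
  omega

lemma sq_mul_altTail (h : SmallBase q) (k : ℕ) : q ^ 2 * altTail q (k + 2) = altTail q k := by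
  rw [sq, mul_assoc, mul_altTail_succ h.ne_zero, mul_altTail_succ h.ne_zero]

lemma gap_pos (h : SmallBase q) : 0 < gap q := by
  rw [gap, sub_pos, lt_div_iff₀ (by linarith [h.one_lt])]
  linarith [h.lt_bound]

lemma gap_lt_altTail_one (h : SmallBase q) : gap q < altTail q 1 := by
  rw [← sub_pos]
  have e : altTail q 1 - gap q = (q ^ 2 - q - 1) / (q ^ 2 - 1) := by
    have := h.ne_zero
    have := h.sub_one_ne
    have := h.sq_sub_one_ne
    rw [altTail, gap]
    field_simp
    ring
  rw [e]
  exact div_pos h.golden h.sq_sub_one_pos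

lemma gap_lt_altTail_two_add_three (h : SmallBase q) : gap q < altTail q 2 + altTail q 3 := by
  rw [← sub_pos]
  have e : altTail q 2 + altTail q 3 - gap q = (q ^ 2 - q - 1) / q ^ 2 := by
    have := h.ne_zero
    have := h.sub_one_ne
    have := h.sq_sub_one_ne
    rw [altTail, altTail, gap]
    field_simp
    ring
  rw [e]
  exact div_pos h.golden (by linarith [h.sq_sub_one_pos])

lemma altTail_two_add_four_lt (h : SmallBase q) :
    altTail q 2 + altTail q 4 + (q ^ 2 - q - 1) < gap q := by
  rw [← sub_pos]
  have h1 := h.one_lt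
  have e : gap q - (altTail q 2 + altTail q 4 + (q ^ 2 - q - 1)) =
      (q ^ 4 + q ^ 3 + 2 * q ^ 2 + q + 1 - q ^ 6) / (q ^ 3 * (q + 1)) := by
    have := h.ne_zero
    have := h.sub_one_ne
    have := h.sq_sub_one_ne
    rw [altTail, altTail, gap]
    field_simp
    ring
  rw [e]
  exact div_pos h.sextic (by positivity)

lemma two_mul_altTail_three_lt (h : SmallBase q) :
    2 * altTail q 3 + (q ^ 2 - q - 1) < gap q := by
  rw [← sub_pos]
  have h1 := h.one_lt
  have e : gap q - (2 * altTail q 3 + (q ^ 2 - q - 1)) =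
      (q ^ 2 - (q ^ 2 - q - 1) * q ^ 4 - 2) / (q ^ 2 * (q ^ 2 - 1)) := by
    have := h.ne_zero
    have := h.sub_one_ne
    have := h.sq_sub_one_ne
    rw [altTail, gap]
    field_simp
    ring
  rw [e]
  have := h.sq_sub_one_pos
  refine div_pos ?_ (by positivity)
  have h4 := h.pow_lt_bound 4 (by norm_num)
  have h2 := h.bound_lt
  nlinarith [mul_lt_mul'' h.golden_lt h4 h.golden.le (by positivity)]

lemma altTail_two_lt_landing (h : SmallBase q) :
    altTail q 2 < 1 + gap q - q ^ 2 * (q ^ 2 - q - 1) - altTail q 0 := by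
  rw [← sub_pos]
  have h1 := h.one_lt
  have e : 1 + gap q - q ^ 2 * (q ^ 2 - q - 1) - altTail q 0 - altTail q 2 =
      (1 - (q ^ 2 - q - 1) * (q ^ 4 + q ^ 3)) / (q * (q + 1)) := by
    have := h.ne_zero
    have := h.sub_one_ne
    have := h.sq_sub_one_ne
    rw [altTail, altTail, gap]
    field_simp
    ring
  rw [e]
  refine div_pos ?_ (by positivity)
  have h4 := h.pow_lt_bound 4 (by norm_num)
  have h3 := h.pow_lt_bound 3 (by norm_num)
  nlinarith [mul_lt_mul'' h.golden_lt (add_lt_add h4 h3) h.golden.le (by positivity)]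

lemma golden_add_altTail_three_lt (h : SmallBase q) :
    (q ^ 2 - q - 1) + altTail q 3 < altTail q 2 := by
  have h1 := h.two_mul_altTail_three_lt
  have h2 := h.gap_lt_altTail_two_add_three
  linarith

lemma landing_lt_altTail_four (h : SmallBase q) :
    q ^ 2 * (q ^ 2 - q - 1) + altTail q 0 - 1 < altTail q 4 := by
  rw [← sub_pos]
  have h1 := h.one_lt
  have e : altTail q 4 - (q ^ 2 * (q ^ 2 - q - 1) + altTail q 0 - 1) =
      (q ^ 4 + q ^ 3 + 2 * q ^ 2 + q + 1 - q ^ 6) * (q - 1) / q ^ 3 := by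
    have := h.ne_zero
    have := h.sub_one_ne
    have := h.sq_sub_one_ne
    rw [altTail, altTail]
    field_simp
    ring
  rw [e]
  exact div_pos (mul_pos h.sextic (by linarith)) (by positivity)

lemma golden_lt_landing (h : SmallBase q) :
    q ^ 2 - q - 1 < q ^ 2 * (q - 1) * (q * (q ^ 2 - q - 1) + altTail q 0 - 1) := by
  rw [← sub_pos]
  have h1 := h.one_lt
  have hg := h.golden
  have e : q ^ 2 * (q - 1) * (q * (q ^ 2 - q - 1) + altTail q 0 - 1) - (q ^ 2 - q - 1) =
      (q ^ 2 - q - 1) * (q ^ 3 * (q ^ 2 - 1) - q ^ 2 - q - 1) / (q + 1) := by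
    have := h.ne_zero
    have := h.sub_one_ne
    have := h.sq_sub_one_ne
    rw [altTail]
    field_simp
    ring
  rw [e]
  refine div_pos (mul_pos hg ?_) (by positivity)
  have h2 : q ^ 3 > 4.2 := by
    have := pow_lt_pow_left₀ h.bound_lt (by norm_num) (n := 3) (by norm_num)
    norm_num at this ⊢
    linarith
  nlinarith [h.sq_sub_one_pos]

lemma sq_mul_gap (h : SmallBase q) : q ^ 2 * gap q = 1 + gap q - (q ^ 2 - q - 1) := by
  have := h.sub_one_ne
  rw [gap]
  field_simp
  ring

lemma mul_gap (h : SmallBase q) : q * gap q = 2 + gap q - q := by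
  have := h.sub_one_ne
  rw [gap]
  field_simp
  ring

lemma sq_mul_altTail_zero (h : SmallBase q) : q ^ 2 * altTail q 0 = altTail q 0 + q := by
  have := h.sq_sub_one_ne
  rw [altTail]
  field_simp
  ring

end SmallBase

lemma ClopenIndecomposable.digit_split {q y : ℝ} (hq : 1 < q)
    (h : ClopenIndecomposable (SigmaSet q y)) :
    (ClopenIndecomposable (SigmaSet q (q * y)) ∧ (SigmaSet q (q * y - 1)).Finite) ∨
      (ClopenIndecomposable (SigmaSet q (q * y - 1)) ∧ (SigmaSet q (q * y)).Finite) := by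
  have hC : IsClopen {ε : ℕ → Fin 2 | ε 0 = 0} :=
    (isClopen_discrete ({0} : Set (Fin 2))).preimage (continuous_apply 0)
  have e0 := image_consSeq_SigmaSet hq y 0
  have e1 := image_consSeq_SigmaSet hq y 1
  rw [Tmap_zero] at e0
  rw [Tmap_one] at e1
  have e2 : SigmaSet q y \ {ε | ε 0 = 0} = SigmaSet q y ∩ {ε | ε 0 = 1} := by
    ext ε
    have : ¬ ε 0 = 0 ↔ ε 0 = 1 := by omega
    simp [this]
  have key : ∀ C ⊆ SigmaSet q y, C.Finite → ClopenIndecomposable (SigmaSet q y \ C) :=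
    fun C _ hf => h.subset sdiff_subset (h.1.sdiff hf)
  rcases h.2 _ hC with hf | hf
  · right
    have h1 := key _ inter_subset_left hf
    rw [sdiff_self_inter, e2, ← e1] at h1
    rw [← e0] at hf
    exact ⟨h1.of_image continuous_tailSeq (tailSeq_consSeq 1),
      hf.of_finite_image (consSeq_injective 0).injOn⟩
  · left
    have h1 := key _ sdiff_subset hf
    rw [sdiff_sdiff_right_self, ← e0] at h1
    rw [e2, ← e1] at hf
    exact ⟨h1.of_image continuous_tailSeq (tailSeq_consSeq 0),
      hf.of_finite_image (consSeq_injective 1).injOn⟩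

lemma ClopenIndecomposable.mul_of_lt {q y : ℝ} (hq : 1 < q)
    (h : ClopenIndecomposable (SigmaSet q y)) (hy : q * y < 1) :
    ClopenIndecomposable (SigmaSet q (q * y)) := by
  rcases h.digit_split hq with h | h
  · exact h.1
  · linarith [(mem_Iq_of_nonempty hq h.1.1.nonempty).1]

lemma ClopenIndecomposable.reflect {q y : ℝ} (hq : 1 < q)
    (h : ClopenIndecomposable (SigmaSet q y)) :
    ClopenIndecomposable (SigmaSet q (1 / (q - 1) - y)) := by
  rw [← image_flipSeq_SigmaSet hq] at h
  exact h.of_image continuous_flipSeq flipSeq_flipSeq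

lemma SigmaSet_subsingleton_Tmap {q y : ℝ} (hq : 1 < q) (h : (SigmaSet q y).Subsingleton)
    (i : Fin 2) : (SigmaSet q (Tmap q i y)).Subsingleton := fun _ hε _ hδ =>
  consSeq_injective i (h ((consSeq_mem_SigmaSet hq).2 hε) ((consSeq_mem_SigmaSet hq).2 hδ))

lemma SigmaSet_subsingleton_reflect {q y : ℝ} (hq : 1 < q) (h : (SigmaSet q y).Subsingleton) :
    (SigmaSet q (1 / (q - 1) - y)).Subsingleton := by
  rw [← image_flipSeq_SigmaSet hq] at h
  exact fun ε hε δ hδ => Function.LeftInverse.injective flipSeq_flipSeq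
    (h (mem_image_of_mem _ hε) (mem_image_of_mem _ hδ))

lemma not_subsingleton_of_mem_switch {q y : ℝ} (hq : q ∈ Ioo (1 : ℝ) 2) (h1 : 1 ≤ q * y)
    (h2 : q * y ≤ 1 / (q - 1)) : ¬ (SigmaSet q y).Subsingleton := by
  intro h
  obtain ⟨ε, hε⟩ := SigmaSet_nonempty (x := Tmap q 0 y) hq
    (by rw [Tmap_zero]; exact ⟨by linarith, h2⟩)
  obtain ⟨δ, hδ⟩ := SigmaSet_nonempty (x := Tmap q 1 y) hq
    (by rw [Tmap_one]; exact ⟨by linarith, by linarith⟩)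
  have := congrFun (h ((consSeq_mem_SigmaSet hq.1).2 hε) ((consSeq_mem_SigmaSet hq.1).2 hδ)) 0
  simp [consSeq] at this

namespace SmallBase

variable {q : ℝ}

lemma mem_Ioo (h : SmallBase q) : q ∈ Ioo (1 : ℝ) 2 := ⟨h.one_lt, by linarith [h.lt_bound]⟩

lemma mul_gap_lt_one (h : SmallBase q) : q * gap q < 1 := by
  have h1 : 1 / (q - 1) < q := by
    rw [div_lt_iff₀ (by linarith [h.one_lt])]
    linarith [h.golden]
  rw [h.mul_gap, gap]
  linarith

lemma gap_lt_one (h : SmallBase q) : gap q < 1 := by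
  nlinarith [h.mul_gap_lt_one, h.one_lt, h.gap_pos]

lemma golden_lt_gap (h : SmallBase q) : q ^ 2 - q - 1 < gap q := by
  linarith [h.two_mul_altTail_three_lt, h.altTail_pos 3]

lemma altTail_zero_eq (h : SmallBase q) : altTail q 0 = q * (1 / (q - 1) - altTail q 0) := by
  have := h.sub_one_ne
  have := h.sq_sub_one_ne
  rw [altTail]
  field_simp
  ring

/-- A point with a unique expansion just to the right of the switch region moves around
`(10)^∞` under a map expanding by the factor `q`, so it equals `(10)^∞`. -/
lemma eq_altTail_zero (h : SmallBase q) {v : ℝ} (hv : (SigmaSet q v).Subsingleton)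
    (h1 : 1 ≤ q * v) (h2 : v ≤ 1) : v = altTail q 0 := by
  have hq := h.one_lt
  have hbound : ∀ n : ℕ, ∀ v : ℝ, (SigmaSet q v).Subsingleton → 1 ≤ q * v → v ≤ 1 →
      q ^ n * |v - altTail q 0| ≤ 2 := by
    intro n
    induction n with
    | zero =>
      intro v hv h1 h2
      have h0 : 0 < v := by nlinarith
      have ha := h.altTail_pos 0
      have ha' : altTail q 0 < 2 := by
        have := h.altTail_two_lt_landing
        have := mul_pos (pow_pos (by linarith : 0 < q) 2) h.golden
        linarith [h.gap_lt_one, h.altTail_pos 2]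
      rw [pow_zero, one_mul, abs_le]
      constructor <;> linarith
    | succ n ih =>
      intro v hv h1 h2
      have h3 : 1 / (q - 1) < q * v := by
        by_contra! h3
        exact not_subsingleton_of_mem_switch h.mem_Ioo h1 h3 hv
      have h4 := SigmaSet_subsingleton_Tmap hq (SigmaSet_subsingleton_reflect hq hv) 0
      rw [Tmap_zero] at h4
      have h5 : (q - 1) * (1 / (q - 1)) = 1 := mul_one_div_cancel h.sub_one_ne
      have h6 := ih _ h4 ?_ ?_
      · have e : q * (1 / (q - 1) - v) - altTail q 0 = -q * (v - altTail q 0) := by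
          linear_combination -h.altTail_zero_eq
        rw [e, abs_mul, abs_neg, abs_of_pos (by linarith : 0 < q)] at h6
        rw [pow_succ, mul_assoc]
        exact h6
      · have h7 := h.sq_mul_gap
        have h8 := h.golden_lt_gap
        have h9 : 0 ≤ q ^ 2 * (1 - v) := mul_nonneg (by positivity) (by linarith)
        rw [gap] at h7 h8
        nlinarith
      · nlinarith
  by_contra hne
  have hpos : 0 < |v - altTail q 0| := abs_pos.2 (sub_ne_zero.2 hne)
  obtain ⟨n, hn⟩ := pow_unbounded_of_one_lt (2 / |v - altTail q 0|) hq
  rw [div_lt_iff₀ hpos] at hn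
  linarith [hbound n v hv h1 h2]

lemma SigmaSet_subsingleton_pow_mul (h : SmallBase q) {y : ℝ}
    (hy : (SigmaSet q y).Subsingleton) (n : ℕ) : (SigmaSet q (q ^ n * y)).Subsingleton := by
  induction n with
  | zero => simpa using hy
  | succ n ih =>
    have := SigmaSet_subsingleton_Tmap h.one_lt ih 0
    rwa [Tmap_zero, ← mul_assoc, ← pow_succ'] at this

lemma eq_zero_or_altTail (h : SmallBase q) {y : ℝ} (hy : (SigmaSet q y).Subsingleton)
    (h0 : 0 ≤ y) (h1 : y ≤ gap q) : y = 0 ∨ ∃ k ≥ 2, y = altTail q k := by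
  rcases h0.eq_or_lt with h0 | h0
  · exact Or.inl h0.symm
  right
  obtain ⟨n, hn1, hn2⟩ := exists_nat_pow_near (x := 1 / y) (y := q)
    (by rw [le_div_iff₀ h0]; linarith [h.gap_lt_one]) h.one_lt
  rw [le_div_iff₀ h0] at hn1
  rw [div_lt_iff₀ h0, pow_succ', mul_assoc] at hn2
  have hv := h.eq_altTail_zero (h.SigmaSet_subsingleton_pow_mul hy n) hn2.le hn1
  have hy' : y = altTail q n := by
    have : q ^ n ≠ 0 := pow_ne_zero _ h.ne_zero
    rw [altTail, eq_div_iff this, mul_comm, hv, altTail, pow_zero, div_one]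
  refine ⟨n, ?_, hy'⟩
  exact h.altTail_strictAnti.lt_iff_gt.1 (hy' ▸ h1.trans_lt h.gap_lt_altTail_one)

/-- Two numbers of the form `0` or `0^k (10)^∞` never add up to `gap q`. -/
lemma add_ne_gap (h : SmallBase q) {u v : ℝ} (hu : u = 0 ∨ ∃ k ≥ 2, u = altTail q k)
    (hv : v = 0 ∨ ∃ k ≥ 2, v = altTail q k) : u + v ≠ gap q := by
  have hanti := h.altTail_strictAnti.antitone
  have h24 := h.altTail_two_add_four_lt
  have h23 := h.gap_lt_altTail_two_add_three
  have h33 := h.two_mul_altTail_three_lt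
  have hg := h.golden
  have hp := h.altTail_pos
  have ordered : ∀ k l : ℕ, 2 ≤ k → k ≤ l → altTail q k + altTail q l ≠ gap q := by
    intro k l hk hkl
    rcases hk.eq_or_lt with rfl | hk
    · rcases le_or_gt l 3 with hl | hl
      · linarith [hanti hl]
      · linarith [hanti (show 4 ≤ l from hl)]
    · linarith [hanti (show 3 ≤ k from hk), hanti (show 3 ≤ l from le_trans hk hkl)]
  rcases hu with rfl | ⟨k, hk, rfl⟩ <;> rcases hv with rfl | ⟨l, hl, rfl⟩
  · linarith [h.gap_pos]
  · linarith [hanti hl, hp 4]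
  · linarith [hanti hk, hp 4]
  · rcases le_total k l with hkl | hkl
    · exact ordered k l hk hkl
    · rw [add_comm]
      exact ordered l k hl hkl

lemma not_both_subsingleton (h : SmallBase q) {y : ℝ} (h0 : (SigmaSet q (q * y)).Subsingleton)
    (h1 : (SigmaSet q (q * y - 1)).Subsingleton) (hy1 : 1 ≤ q * y) (hy2 : q * y ≤ 1 / (q - 1)) :
    False := by
  refine h.add_ne_gap (h.eq_zero_or_altTail h1 (by linarith) (by rw [gap]; linarith))
    (h.eq_zero_or_altTail (SigmaSet_subsingleton_reflect h.one_lt h0) (by linarith)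
      (by rw [gap]; linarith)) ?_
  rw [gap]
  ring

lemma mem_switch_of_digits (h : SmallBase q) {y : ℝ} {ε δ : ℕ → Fin 2} (hε : ε ∈ SigmaSet q y)
    (hδ : δ ∈ SigmaSet q y) (hne : ε 0 ≠ δ 0) :
    1 ≤ q * y ∧ q * y ≤ 1 / (q - 1) ∧ (SigmaSet q (q * y)).Nonempty ∧
      (SigmaSet q (q * y - 1)).Nonempty := by
  wlog h0 : ε 0 = 0 generalizing ε δ
  · exact this hδ hε hne.symm (by omega)
  have h1 : δ 0 = 1 := by omega
  have hε' := tailSeq_mem_SigmaSet h.one_lt hε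
  have hδ' := tailSeq_mem_SigmaSet h.one_lt hδ
  rw [h0, Tmap_zero] at hε'
  rw [h1, Tmap_one] at hδ'
  have a0 := (mem_Iq_of_nonempty h.one_lt ⟨_, hε'⟩).2
  have a1 := (mem_Iq_of_nonempty h.one_lt ⟨_, hδ'⟩).1
  exact ⟨by linarith, a0, ⟨_, hε'⟩, ⟨_, hδ'⟩⟩

lemma ncard_Tmap_le (h : SmallBase q) {y : ℝ} (hf : (SigmaSet q y).Finite) (i : Fin 2) :
    (SigmaSet q (Tmap q i y)).Finite ∧
      (SigmaSet q (Tmap q i y)).ncard ≤ (SigmaSet q y).ncard := by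
  have hsub : consSeq i '' SigmaSet q (Tmap q i y) ⊆ SigmaSet q y :=
    (image_consSeq_SigmaSet h.one_lt y i).trans_subset inter_subset_left
  refine ⟨(hf.subset hsub).of_finite_image (consSeq_injective i).injOn, ?_⟩
  rw [← ncard_image_of_injective _ (consSeq_injective i)]
  exact ncard_le_ncard hsub hf

lemma ncard_Tmap_lt (h : SmallBase q) {y : ℝ} (hf : (SigmaSet q y).Finite) {i j : Fin 2}
    (hij : i ≠ j) (hj : (SigmaSet q (Tmap q j y)).Nonempty) :
    (SigmaSet q (Tmap q i y)).ncard < (SigmaSet q y).ncard := by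
  rw [← ncard_image_of_injective _ (consSeq_injective i)]
  refine ncard_lt_ncard ⟨(image_consSeq_SigmaSet h.one_lt y i).trans_subset inter_subset_left,
    fun hsub => ?_⟩ hf
  obtain ⟨ε, hε⟩ := hj
  obtain ⟨δ, -, hδ⟩ := hsub ((consSeq_mem_SigmaSet h.one_lt).2 hε)
  exact hij (congrFun hδ 0)

lemma subsingleton_of_finite (h : SmallBase q) {y : ℝ} (hf : (SigmaSet q y).Finite) :
    (SigmaSet q y).Subsingleton := by
  induction hn : (SigmaSet q y).ncard using Nat.strong_induction_on generalizing y with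
  | _ n ih =>
  have key : ∀ m : ℕ, ∀ z : ℝ, (SigmaSet q z).Finite → (SigmaSet q z).ncard ≤ n →
      ∀ ε ∈ SigmaSet q z, ∀ δ ∈ SigmaSet q z, ε m = δ m := by
    intro m
    have head : ∀ z : ℝ, (SigmaSet q z).Finite → (SigmaSet q z).ncard ≤ n →
        ∀ ε ∈ SigmaSet q z, ∀ δ ∈ SigmaSet q z, ε 0 = δ 0 := by
      intro z hz hzn ε hε δ hδ
      by_contra hne
      obtain ⟨hs1, hs2, n0, n1⟩ := h.mem_switch_of_digits hε hδ hne
      rw [← Tmap_zero] at n0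
      rw [← Tmap_one] at n1
      have s0 := ih _ ((h.ncard_Tmap_lt hz (by decide) n1).trans_le hzn)
        (h.ncard_Tmap_le hz 0).1 rfl
      have s1 := ih _ ((h.ncard_Tmap_lt hz (by decide) n0).trans_le hzn)
        (h.ncard_Tmap_le hz 1).1 rfl
      rw [Tmap_zero] at s0
      rw [Tmap_one] at s1
      exact h.not_both_subsingleton s0 s1 hs1 hs2
    induction m with
    | zero => exact head
    | succ m ihm =>
      intro z hz hzn ε hε δ hδ
      have hε' := tailSeq_mem_SigmaSet h.one_lt hε
      have hδ' := tailSeq_mem_SigmaSet h.one_lt hδ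
      rw [← head z hz hzn ε hε δ hδ] at hδ'
      have hT := h.ncard_Tmap_le hz (ε 0)
      exact ihm _ hT.1 (hT.2.trans hzn) _ hε' _ hδ'
  intro ε hε δ hδ
  funext m
  exact key m y hf hn.le ε hε δ hδ

end SmallBase

/-- `u` is the point with a unique expansion reached from the switch region by one digit, while
the other digit leads (up to reflection) to `gap q - u`, which keeps branching. -/
def IsResidual (q u : ℝ) : Prop :=
  (u = 0 ∨ ∃ k ≥ 2, u = altTail q k) ∧ ClopenIndecomposable (SigmaSet q (gap q - u))

namespace SmallBase

variable {q : ℝ}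

lemma isResidual_of_switch (h : SmallBase q) {s t : ℝ} (hs : ClopenIndecomposable (SigmaSet q s))
    (ht : q * s - 1 = t) (h0 : 0 ≤ t) (h1 : t ≤ gap q) :
    IsResidual q t ∨ IsResidual q (gap q - t) := by
  subst ht
  rcases hs.digit_split h.one_lt with ⟨hi, hf⟩ | ⟨hi, hf⟩
  · refine Or.inl ⟨h.eq_zero_or_altTail (h.subsingleton_of_finite hf) h0 h1, ?_⟩
    have e : gap q - (q * s - 1) = 1 / (q - 1) - q * s := by rw [gap]; ring
    exact e ▸ hi.reflect h.one_lt
  · refine Or.inr ⟨h.eq_zero_or_altTail ?_ (by linarith) (by linarith), by rwa [sub_sub_cancel]⟩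
    have e : gap q - (q * s - 1) = 1 / (q - 1) - q * s := by rw [gap]; ring
    exact e ▸ SigmaSet_subsingleton_reflect h.one_lt (h.subsingleton_of_finite hf)

lemma exists_isResidual (h : SmallBase q) {y : ℝ} (hy : ClopenIndecomposable (SigmaSet q y)) :
    ∃ u, IsResidual q u := by
  obtain ⟨ε, hε, δ, hδ, hne⟩ := hy.1.nontrivial
  obtain ⟨m, hm⟩ := Function.ne_iff.1 hne
  clear hne
  have head : ∀ z : ℝ, ClopenIndecomposable (SigmaSet q z) → ∀ ε ∈ SigmaSet q z,
      ∀ δ ∈ SigmaSet q z, ε 0 ≠ δ 0 → ∃ u, IsResidual q u := by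
    intro z hz ε hε δ hδ hne
    obtain ⟨h1, h2, -, -⟩ := h.mem_switch_of_digits hε hδ hne
    rcases h.isResidual_of_switch hz rfl (by linarith) (by rw [gap]; linarith) with h | h
    exacts [⟨_, h⟩, ⟨_, h⟩]
  induction m generalizing y ε δ with
  | zero => exact head y hy ε hε δ hδ hm
  | succ m ih =>
    by_cases hd : ∃ ε' ∈ SigmaSet q y, ∃ δ' ∈ SigmaSet q y, ε' 0 ≠ δ' 0
    · obtain ⟨ε', hε', δ', hδ', hne⟩ := hd
      exact head y hy ε' hε' δ' hδ' hne
    push Not at hd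
    have hε' := tailSeq_mem_SigmaSet h.one_lt hε
    have hδ' := tailSeq_mem_SigmaSet h.one_lt hδ
    rw [← hd ε hε δ hδ] at hδ'
    refine ih ?_ _ hε' _ hδ' hm
    have e := image_consSeq_SigmaSet h.one_lt y (ε 0)
    have hhead : SigmaSet q y ⊆ {ε' | ε' 0 = ε 0} := fun ε' hε' => hd ε' hε' ε hε
    rw [inter_eq_left.2 hhead] at e
    rw [← e] at hy
    exact hy.of_image continuous_tailSeq (tailSeq_consSeq _)

end SmallBase

lemma IsResidual.le_altTail_two {q u : ℝ} (h : SmallBase q) (hu : IsResidual q u) :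
    u ≤ altTail q 2 := by
  rcases hu.1 with rfl | ⟨k, hk, rfl⟩
  · exact (h.altTail_pos 2).le
  · exact h.altTail_strictAnti.antitone hk

lemma IsResidual.exists_eq {q u : ℝ} (hu : IsResidual q u) (h0 : 0 < u) :
    ∃ k ≥ 2, u = altTail q k :=
  hu.1.resolve_left h0.ne'

namespace SmallBase

variable {q : ℝ}

lemma isResidual_step (h : SmallBase q) {u : ℝ} (hu : IsResidual q u) (h0 : 0 ≤ u)
    (h1 : q ^ 2 * u + (q ^ 2 - q - 1) ≤ gap q) :
    IsResidual q (gap q - (q ^ 2 * u + (q ^ 2 - q - 1))) ∨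
      IsResidual q (q ^ 2 * u + (q ^ 2 - q - 1)) := by
  have hq := h.one_lt
  have hg := h.golden
  have hs := hu.2.mul_of_lt hq (by nlinarith [h.mul_gap_lt_one])
  have h2 : 0 ≤ q ^ 2 * u := by positivity
  have h3 := h.isResidual_of_switch hs (t := gap q - (q ^ 2 * u + (q ^ 2 - q - 1)))
    (by linear_combination h.sq_mul_gap) (by linarith) (by linarith)
  rwa [sub_sub_cancel] at h3

lemma isResidual_step_of_le (h : SmallBase q) {u : ℝ} (hu : IsResidual q u) (h0 : 0 ≤ u)
    (h1 : u ≤ altTail q 6) : IsResidual q (q ^ 2 * u + (q ^ 2 - q - 1)) := by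
  have h2 : q ^ 2 * u ≤ altTail q 4 := by
    rw [← h.sq_mul_altTail 4]
    gcongr
  have h3 := h.altTail_two_add_four_lt
  refine (h.isResidual_step hu h0 (by linarith [h.altTail_pos 2])).resolve_left fun h4 => ?_
  linarith [h4.le_altTail_two h]

lemma not_isResidual_of_between (h : SmallBase q) {u : ℝ} (l : ℕ) (h1 : altTail q (l + 1) < u)
    (h2 : u < altTail q l) : ¬ IsResidual q u := by
  intro hu
  obtain ⟨k, -, rfl⟩ := hu.exists_eq ((h.altTail_pos _).trans h1)
  exact h.altTail_between h1 h2

lemma not_isResidual_altTail_four (h : SmallBase q) : ¬ IsResidual q (altTail q 4) := by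
  intro hu
  have e := h.sq_mul_altTail 2
  have h24 := h.altTail_two_add_four_lt
  have h23 := h.gap_lt_altTail_two_add_three
  have hg := h.golden
  have hstep := h.isResidual_step hu (h.altTail_pos 4).le
    (by rw [e]; linarith [h.altTail_pos 4])
  rw [e] at hstep
  rcases hstep with h1 | h1
  · exact h.not_isResidual_of_between 3 (by linarith) (by linarith) h1
  · linarith [h1.le_altTail_two h]

lemma not_isResidual_altTail_five (h : SmallBase q) : ¬ IsResidual q (altTail q 5) := by
  intro hu
  have e := h.sq_mul_altTail 3
  have h33 := h.two_mul_altTail_three_lt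
  have h23 := h.gap_lt_altTail_two_add_three
  have hg := h.golden
  have hstep := h.isResidual_step hu (h.altTail_pos 5).le
    (by rw [e]; linarith [h.altTail_pos 3])
  rw [e] at hstep
  rcases hstep with h1 | h1
  · exact h.not_isResidual_of_between 2 (by linarith) (by linarith) h1
  · exact h.not_isResidual_of_between 2 (by linarith)
      (by linarith [h.golden_add_altTail_three_lt]) h1

lemma not_isResidual_landing (h : SmallBase q) {u : ℝ} (h1 : u < altTail q 4)
    (h2 : q ^ 2 - q - 1 < q ^ 2 * (q - 1) * u) : ¬ IsResidual q u := by
  intro hu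
  have hq := h.one_lt
  have hg := h.golden
  have h0 : 0 < u := by
    by_contra! h0
    nlinarith [mul_pos (pow_pos (by linarith : 0 < q) 2) (by linarith : 0 < q - 1)]
  obtain ⟨l, -, rfl⟩ := hu.exists_eq h0
  have hl : 4 < l := h.altTail_strictAnti.lt_iff_gt.1 h1
  rcases (show 5 ≤ l from hl).eq_or_lt with rfl | hl6
  · exact h.not_isResidual_altTail_five hu
  obtain ⟨m, rfl⟩ : ∃ m, l = m + 6 := ⟨l - 6, by omega⟩
  have h3 := h.isResidual_step_of_le hu h0.le (h.altTail_strictAnti.antitone (by omega))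
  have e4 := h.sq_mul_altTail (m + 4)
  have e3 := mul_altTail_succ h.ne_zero (m + 3)
  refine h.not_isResidual_of_between (m + 3) ?_ ?_ h3
  · linarith
  · rw [← e3, ← e4]
    linarith

lemma landing_pos (h : SmallBase q) : 0 < q * (q ^ 2 - q - 1) + altTail q 0 - 1 := by
  have h1 := h.golden.trans h.golden_lt_landing
  have hq := h.one_lt
  exact pos_of_mul_pos_right h1 (mul_nonneg (by positivity) (by linarith))

lemma landing_lt (h : SmallBase q) : q * (q ^ 2 - q - 1) + altTail q 0 - 1 <
    q ^ 2 * (q ^ 2 - q - 1) + altTail q 0 - 1 := by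
  nlinarith [mul_pos (mul_pos (by linarith [h.one_lt] : 0 < q) h.golden)
    (by linarith [h.one_lt] : 0 < q - 1)]

lemma not_isResidual_altTail_three (h : SmallBase q) : ¬ IsResidual q (altTail q 3) := by
  intro hu
  have hq := h.one_lt
  have hg := h.golden
  have hp := h.altTail_pos
  have e2 := mul_altTail_succ h.ne_zero 2
  have e1 := h.sq_mul_altTail 1
  have e0 := mul_altTail_succ h.ne_zero 0
  have s1 := hu.2.mul_of_lt hq (by rw [mul_sub, e2]; linarith [h.mul_gap_lt_one, hp 2])
  have w2 : q * (q * (gap q - altTail q 3)) = 1 + gap q - (q ^ 2 - q - 1) - altTail q 1 := by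
    linear_combination h.sq_mul_gap - e1
  have s2 := s1.mul_of_lt hq (by rw [w2]; linarith [h.gap_lt_altTail_one])
  have hland := h.altTail_two_lt_landing
  have hpos := h.landing_pos
  have hlt := h.landing_lt
  rcases h.isResidual_of_switch s2
    (t := gap q - (q * (q ^ 2 - q - 1) + altTail q 0 - 1))
    (by rw [w2]; linear_combination h.mul_gap - e0) (by linarith [hp 2]) (by linarith) with h1 | h1
  · linarith [h1.le_altTail_two h]
  · rw [sub_sub_cancel] at h1
    exact h.not_isResidual_landing (hlt.trans h.landing_lt_altTail_four) h.golden_lt_landing h1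

lemma not_isResidual_altTail_two (h : SmallBase q) : ¬ IsResidual q (altTail q 2) := by
  intro hu
  have hq := h.one_lt
  have hg := h.golden
  have hp := h.altTail_pos
  have e1 := mul_altTail_succ h.ne_zero 1
  have e0 := h.sq_mul_altTail 0
  have e0' := mul_altTail_succ h.ne_zero 0
  have h10 := h.altTail_lt_succ 0
  have hgap := h.gap_lt_altTail_one
  have s1 := hu.2.mul_of_lt hq (by rw [mul_sub, e1]; linarith [h.mul_gap_lt_one, hp 1])
  have w2 : q * (q * (gap q - altTail q 2)) = 1 + gap q - (q ^ 2 - q - 1) - altTail q 0 := by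
    linear_combination h.sq_mul_gap - e0
  have s2 := s1.mul_of_lt hq (by rw [w2]; linarith)
  have hq0 : q * altTail q 0 = altTail q 1 + 1 := by
    refine mul_left_cancel₀ h.ne_zero ?_
    linear_combination h.sq_mul_altTail_zero - e0'
  have w3 : q * (q * (q * (gap q - altTail q 2))) =
      1 + gap q - q * (q ^ 2 - q - 1) - altTail q 1 := by
    rw [w2]
    linear_combination h.mul_gap - hq0
  have s3 := s2.mul_of_lt hq (by rw [w3]; nlinarith [mul_pos (by linarith : 0 < q) hg])
  have hland := h.altTail_two_lt_landing
  have hpos := h.landing_pos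
  have hlt := h.landing_lt
  rcases h.isResidual_of_switch s3
    (t := gap q - (q ^ 2 * (q ^ 2 - q - 1) + altTail q 0 - 1))
    (by rw [w3]; linear_combination h.mul_gap - e0') (by linarith [hp 2]) (by linarith) with h1 | h1
  · linarith [h1.le_altTail_two h]
  · rw [sub_sub_cancel] at h1
    refine h.not_isResidual_landing h.landing_lt_altTail_four (h.golden_lt_landing.trans ?_) h1
    exact mul_lt_mul_of_pos_left hlt (mul_pos (by positivity) (by linarith))

lemma not_isResidual_altTail (h : SmallBase q) (k : ℕ) (hk : 2 ≤ k) :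
    ¬ IsResidual q (altTail q k) := by
  induction k using Nat.strong_induction_on with
  | _ k ih =>
  intro hu
  rcases lt_or_ge k 6 with h6 | h6
  · interval_cases k
    exacts [h.not_isResidual_altTail_two hu, h.not_isResidual_altTail_three hu,
      h.not_isResidual_altTail_four hu, h.not_isResidual_altTail_five hu]
  have hp := h.altTail_pos k
  have h1 := h.isResidual_step_of_le hu hp.le (h.altTail_strictAnti.antitone h6)
  have hlt : altTail q k < q ^ 2 * altTail q k + (q ^ 2 - q - 1) := by
    nlinarith [h.golden, mul_pos h.sq_sub_one_pos hp]
  obtain ⟨l, hl, hul⟩ := h1.exists_eq (hp.trans hlt)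
  rw [hul] at h1 hlt
  exact ih l (h.altTail_strictAnti.lt_iff_gt.1 hlt) hl h1

lemma not_isResidual (h : SmallBase q) (u : ℝ) : ¬ IsResidual q u := by
  intro hu
  rcases hu.1 with rfl | ⟨k, hk, rfl⟩
  · have h1 := h.isResidual_step_of_le hu le_rfl (h.altTail_pos 6).le
    obtain ⟨k, hk, e⟩ := h1.exists_eq (by linarith [h.golden])
    exact h.not_isResidual_altTail k hk (e ▸ h1)
  · exact h.not_isResidual_altTail k hk hu

end SmallBase

/-- Following the digits of a cylinder leads to a point all of whose expansions form a clopen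
indecomposable set. -/
lemma exists_clopenIndecomposable_SigmaSet {q : ℝ} (hq : 1 < q) {x : ℝ} {ε : ℕ → Fin 2} {n : ℕ}
    (h : ClopenIndecomposable (SigmaSet q x ∩ PiNat.cylinder ε n)) :
    ∃ y, ClopenIndecomposable (SigmaSet q y) := by
  induction n generalizing x ε with
  | zero => exact ⟨x, by simpa using h⟩
  | succ n ih =>
    have e : consSeq (ε 0) '' (SigmaSet q (Tmap q (ε 0) x) ∩ PiNat.cylinder (tailSeq ε) n) =
        SigmaSet q x ∩ PiNat.cylinder ε (n + 1) := by
      ext δ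
      simp only [mem_image, mem_inter_iff, PiNat.mem_cylinder_iff]
      constructor
      · rintro ⟨δ, ⟨hδ, hc⟩, rfl⟩
        refine ⟨(consSeq_mem_SigmaSet hq).2 hδ, fun i hi => ?_⟩
        cases i with
        | zero => rfl
        | succ i => exact hc i (by omega)
      · rintro ⟨hδ, hc⟩
        have h0 := hc 0 (by omega)
        refine ⟨tailSeq δ, ⟨h0 ▸ tailSeq_mem_SigmaSet hq hδ, fun i hi => hc (i + 1) (by omega)⟩, ?_⟩
        rw [← h0, consSeq_head_tail]
    rw [← e] at h
    exact ih (h.of_image continuous_tailSeq (tailSeq_consSeq _))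

lemma SmallBase.of_lt_root {q qA : ℝ} (hq : (1 + Real.sqrt 5) / 2 < q) (hqA : q < qA)
    (hroot : qA ^ 6 = qA ^ 4 + qA ^ 3 + 2 * qA ^ 2 + qA + 1) : SmallBase q := by
  have h5 : Real.sqrt 5 ^ 2 = 5 := Real.sq_sqrt (by norm_num)
  have h5' : 1 < Real.sqrt 5 := Real.lt_sqrt_of_sq_lt (by norm_num)
  have hq1 : 1 < q := by linarith
  refine ⟨hq1, by nlinarith, ?_⟩
  obtain ⟨t, ht, rfl⟩ : ∃ t, 1 < t ∧ qA = t * q :=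
    ⟨qA / q, by rwa [one_lt_div (by linarith)], by field_simp⟩
  have h4 : t ^ 4 * q ^ 4 < t ^ 6 * q ^ 4 := by gcongr; norm_num
  have h3 : t ^ 3 * q ^ 3 < t ^ 6 * q ^ 3 := by gcongr; norm_num
  have h2 : t ^ 2 * q ^ 2 < t ^ 6 * q ^ 2 := by gcongr; norm_num
  have h1 : t ^ 1 * q < t ^ 6 * q := by gcongr; norm_num
  have h0 : 1 < t ^ 6 := one_lt_pow₀ ht (by norm_num)
  refine pos_of_mul_pos_right (a := t ^ 6) ?_ (by positivity)
  simp only [mul_pow] at hroot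
  linarith

/-- `((1+√5)/2, q_{ℵ₀}) ∩ B_{ℵ₀} = ∅`. -/
theorem no_BAleph0_between_golden_and_qAleph0
    (qA : ℝ) (hqA1 : qA ∈ Set.Ioo (1 : ℝ) 2)
    (hqA2 : qA ^ 6 = qA ^ 4 + qA ^ 3 + 2 * qA ^ 2 + qA + 1) :
    Set.Ioo ((1 + Real.sqrt 5) / 2) qA ∩ BAleph0 = ∅ := by
  rw [Set.eq_empty_iff_forall_notMem]
  rintro q ⟨⟨hq, hqA⟩, -, x, -, hcard⟩
  have h := SmallBase.of_lt_root hq hqA hqA2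
  have hinf : (SigmaSet q x).Infinite := by
    rw [← Set.infinite_coe_iff, Cardinal.infinite_iff, hcard]
  have hcount : (SigmaSet q x).Countable := by
    rw [← Cardinal.le_aleph0_iff_set_countable, hcard]
  obtain ⟨ε, n, hε⟩ :=
    exists_clopenIndecomposable_inter_cylinder (isClosed_SigmaSet h.one_lt x) hinf hcount
  obtain ⟨y, hy⟩ := exists_clopenIndecomposable_SigmaSet h.one_lt hε
  obtain ⟨u, hu⟩ := h.exists_isResidual hy
  exact h.not_isResidual u hu
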